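/- Let x be a B-letter-balanced infinite word over a finite alphabet A whose letter frequencies ν_a = μ_x(a) exist for all a ∈ A. Let τ : A → B* be a substitution that is k-decisive in x, and suppose the infinite word τ(x) is P-power-free for some integer P ≥ 1. Fix a factor u of τ(x) with 1 ≤ |u| ≤ k+1 and set μ_u = (Σ_{a∈A} ν_a · q_{τ,x}(u,a)) / (Σ_{a∈A} ν_a · |τ(a)|). Then for every factor w of x, | |τ(w)|_u − μ_u·|τ(w)| | ≤ 2·P·B·‖τ‖/|u| + 2·P. In particular, the frequency of u in τ(x) exists and equals μ_u. -/

import Mathlib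

open scoped Classical

section Core

variable {A : Type*} {B : Type*}

/-- `w` occurs at position `i` of the infinite word `x`. -/
def OccursAt (x : ℕ → A) (w : List A) (i : ℕ) : Prop :=
  w = (List.range w.length).map fun j => x (i + j)

/-- `w` is a factor of the infinite word `x`. -/
def IsFactor (x : ℕ → A) (w : List A) : Prop := ∃ i, OccursAt x w i

/-- The number of (possibly overlapping) occurrences of `w` in the finite word `u`,
i.e. `|u|_w`. -/
noncomputable def countOccs (u w : List A) : ℕ :=
  ((Finset.range (u.length + 1)).filter fun i => w <+: u.drop i).card

/-- The finite word `w` is `C`-balanced in the infinite word `x`. -/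
def BalancedIn (C : ℝ) (w : List A) (x : ℕ → A) : Prop :=
  ∀ u v : List A, IsFactor x u → IsFactor x v → u.length = v.length →
    |(countOccs u w : ℝ) - (countOccs v w : ℝ)| ≤ C

/-- Every finite word is `C_w`-balanced in `x` for some constant `C_w > 0`. -/
def FactorBalanced (x : ℕ → A) : Prop :=
  ∀ w : List A, ∃ C : ℝ, 0 < C ∧ BalancedIn C w x

/-- There is a single constant `C > 0` such that every finite word is `C`-balanced in `x`. -/
def UniformlyFactorBalanced (x : ℕ → A) : Prop :=
  ∃ C : ℝ, 0 < C ∧ ∀ w : List A, BalancedIn C w x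

/-- Every letter is `C`-balanced in `x`. -/
def LetterBalanced (C : ℝ) (x : ℕ → A) : Prop :=
  ∀ a : A, BalancedIn C [a] x

/-- `x` is `P`-power-free: no factor of `x` is a `P`-th power of a nonempty word. -/
def PowerFree (P : ℕ) (x : ℕ → A) : Prop :=
  ∀ v : List A, v ≠ [] → ¬ IsFactor x (List.flatten (List.replicate P v))

/-- The length-`n` prefix of the infinite word `x`. -/
def wordPrefix (x : ℕ → A) (n : ℕ) : List A := (List.range n).map x

/-- The extension of a substitution to finite words. -/
def substWord (τ : A → List B) (w : List A) : List B := (w.map τ).flatten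

/-- The word `w` has (prefix) frequency `μ` in `x`. -/
def HasFreq (x : ℕ → A) (w : List A) (μ : ℝ) : Prop :=
  Filter.Tendsto (fun n => (countOccs (wordPrefix x n) w : ℝ) / n)
    Filter.atTop (nhds μ)

/-- `τ` is `k`-decisive in `x` with witness map `r` (each `r a` of length `k ≥ 1`,
and `τ b` starts with `r a` whenever `ab` is a factor of `x`). -/
def DecisiveWith (τ : A → List B) (x : ℕ → A) (r : A → List B) (k : ℕ) : Prop :=
  1 ≤ k ∧ (∀ a, (r a).length = k) ∧
    ∀ a b : A, IsFactor x [a, b] → r a <+: τ b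

/-- `τ` is `k`-decisive in `x`. -/
def Decisive (τ : A → List B) (x : ℕ → A) (k : ℕ) : Prop :=
  ∃ r : A → List B, DecisiveWith τ x r k

/-- The image of the infinite word `x` under the substitution `τ`: when the images of
prefixes of `x` have unbounded length, `substInf τ x` is the infinite word `τ(x)`. -/
noncomputable def substInf [Nonempty B] (τ : A → List B) (x : ℕ → A) (j : ℕ) : B :=
  if h : ∃ n, j < (substWord τ (wordPrefix x n)).length
  then (substWord τ (wordPrefix x (Nat.find h))).get ⟨j, Nat.find_spec h⟩
  else Classical.arbitrary B

/-- Iterates of a substitution: `substIter τ n a = τ^n(a)` as a finite word. -/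
def substIter (τ : A → List A) : ℕ → A → List A
  | 0, a => [a]
  | n+1, a => substWord (substIter τ n) (τ a)

/-- `τ` is prolongable on the letter `a`. -/
def Prolongable (τ : A → List A) (a : A) : Prop :=
  (τ a).head? = some a ∧ (∀ b, τ b ≠ []) ∧
    Filter.Tendsto (fun n => (substIter τ n a).length) Filter.atTop Filter.atTop

/-- The fixed point `τ^ω(a)` of a substitution prolongable on `a`:
the limit of the prefix chain `τ^n(a)`. -/
noncomputable def fixedPoint (τ : A → List A) (a : A) (j : ℕ) : A :=
  if h : ∃ n, j < (substIter τ n a).length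
  then (substIter τ (Nat.find h) a).get ⟨j, Nat.find_spec h⟩
  else a

/-- The factor complexity of `x`: the number of distinct length-`n` factors. -/
noncomputable def complexity (x : ℕ → A) (n : ℕ) : ℕ :=
  Set.ncard {w : List A | w.length = n ∧ IsFactor x w}

/-- Every factor of `x` occurs infinitely often in `x`. -/
def Recurrent (x : ℕ → A) : Prop :=
  ∀ w : List A, IsFactor x w → ∀ N : ℕ, ∃ i, N ≤ i ∧ OccursAt x w i

/-- For every factor `w` of `x` there is `k` such that `w` occurs in
every length-`k` factor of `x`. -/
def UniformlyRecurrent (x : ℕ → A) : Prop :=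
  ∀ w : List A, IsFactor x w → ∃ k : ℕ, ∀ v : List A, IsFactor x v →
    v.length = k → 1 ≤ countOccs v w

end Core

section Occurrences

variable {A : Type*}

theorem occursAt_iff {x : ℕ → A} {w : List A} {i : ℕ} :
    OccursAt x w i ↔ ∀ j < w.length, w[j]? = some (x (i + j)) := by
  unfold OccursAt
  constructor
  · intro h j hj
    rw [h]
    simp [hj]
  · intro h
    apply List.ext_getElem?
    intro j
    by_cases hj : j < w.length
    · rw [h j hj]
      simp [hj]
    · simp [hj]

theorem occursAt_append {x : ℕ → A} {v w : List A} {i : ℕ} :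
    OccursAt x (v ++ w) i ↔ OccursAt x v i ∧ OccursAt x w (i + v.length) := by
  simp only [occursAt_iff, List.length_append]
  constructor
  · intro h
    refine ⟨fun j hj => ?_, fun j hj => ?_⟩
    · rw [← h j (by omega), List.getElem?_append_left hj]
    · have := h (v.length + j) (by omega)
      rw [List.getElem?_append_right (by omega)] at this
      simpa [add_assoc] using this
  · rintro ⟨h1, h2⟩ j hj
    by_cases hjv : j < v.length
    · rw [List.getElem?_append_left hjv, h1 j hjv]
    · rw [List.getElem?_append_right (by omega), h2 _ (by omega)]
      congr 2
      omega

theorem OccursAt.of_isPrefix {x : ℕ → A} {v w : List A} {i : ℕ} (h : OccursAt x w i)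
    (hv : v <+: w) : OccursAt x v i := by
  obtain ⟨t, rfl⟩ := hv
  exact (occursAt_append.1 h).1

theorem OccursAt.take {x : ℕ → A} {w : List A} {i : ℕ} (h : OccursAt x w i) (n : ℕ) :
    OccursAt x (w.take n) i :=
  h.of_isPrefix ⟨_, List.take_append_drop _ _⟩

theorem OccursAt.eq_of_length {x : ℕ → A} {v w : List A} {i : ℕ} (hv : OccursAt x v i)
    (hw : OccursAt x w i) (hl : v.length = w.length) : v = w := by
  rw [OccursAt] at hv hw
  rw [hv, hw, hl]

theorem OccursAt.drop {x : ℕ → A} {w : List A} {i : ℕ} (h : OccursAt x w i) {n : ℕ}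
    (hn : n ≤ w.length) : OccursAt x (w.drop n) (i + n) := by
  rw [← List.take_append_drop n w] at h
  simpa [hn] using (occursAt_append.1 h).2

theorem occursAt_map_range (x : ℕ → A) (i n : ℕ) :
    OccursAt x ((List.range n).map fun j => x (i + j)) i := by
  simp [OccursAt]

theorem isFactor_pair (x : ℕ → A) (i : ℕ) : IsFactor x [x i, x (i + 1)] :=
  ⟨i, by simp [OccursAt, List.range_succ]⟩

theorem occursAt_singleton {x : ℕ → A} {a : A} {i : ℕ} : OccursAt x [a] i ↔ x i = a := by
  simp [OccursAt, eq_comm]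

/-- The number of occurrences of `u` in `x` at positions in `[s, e)`. -/
noncomputable def occCount (x : ℕ → A) (u : List A) (s e : ℕ) : ℕ :=
  ((Finset.Ico s e).filter fun p => OccursAt x u p).card

theorem countOccs_eq_occCount {x : ℕ → A} {v u : List A} {s : ℕ} (hv : OccursAt x v s)
    (hu : 1 ≤ u.length) : countOccs v u = occCount x u s (s + v.length + 1 - u.length) := by
  unfold countOccs occCount
  apply Finset.card_bij (fun p _ => s + p)
  · intro p hp
    simp only [Finset.mem_filter, Finset.mem_range, Finset.mem_Ico] at hp ⊢
    have hl := hp.2.length_le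
    rw [List.length_drop] at hl
    exact ⟨by omega, (hv.drop (by omega)).of_isPrefix hp.2⟩
  · intro p _ q _ h
    omega
  · intro p hp
    simp only [Finset.mem_filter, Finset.mem_Ico] at hp
    refine ⟨p - s, ?_, by omega⟩
    simp only [Finset.mem_filter, Finset.mem_range]
    refine ⟨by omega, ?_⟩
    have h1 := hv.drop (n := p - s) (by omega)
    rw [show s + (p - s) = p by omega] at h1
    have h2 := h1.take u.length
    rw [hp.2.eq_of_length h2 (by simp; omega)]
    exact ⟨_, List.take_append_drop _ _⟩

theorem occCount_add (x : ℕ → A) (u : List A) {s m e : ℕ} (h1 : s ≤ m) (h2 : m ≤ e) :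
    occCount x u s e = occCount x u s m + occCount x u m e := by
  unfold occCount
  rw [← Finset.Ico_union_Ico_eq_Ico h1 h2, Finset.filter_union, Finset.card_union_of_disjoint]
  exact Finset.disjoint_filter_filter (Finset.Ico_disjoint_Ico_consecutive s m e)

theorem occCount_le_add (x : ℕ → A) (u : List A) (s m e : ℕ) :
    occCount x u s e ≤ occCount x u s m + occCount x u m e := by
  unfold occCount
  refine le_trans (Finset.card_le_card ?_) (Finset.card_union_le _ _)
  intro p
  simp only [Finset.mem_filter, Finset.mem_Ico, Finset.mem_union]
  rintro ⟨h, h'⟩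
  by_cases hp : p < m
  · exact Or.inl ⟨⟨h.1, hp⟩, h'⟩
  · exact Or.inr ⟨⟨by omega, h.2⟩, h'⟩

theorem occCount_mono (x : ℕ → A) (u : List A) (s : ℕ) {e e' : ℕ} (h : e ≤ e') :
    occCount x u s e ≤ occCount x u s e' :=
  Finset.card_le_card (Finset.filter_subset_filter _ (Finset.Ico_subset_Ico_right h))

theorem occCount_le (x : ℕ → A) (u : List A) (s e : ℕ) : occCount x u s e ≤ e - s := by
  simpa [occCount] using Finset.card_filter_le (Finset.Ico s e) fun p => OccursAt x u p

theorem occCount_eq_sum (x : ℕ → A) (u : List A) {s : ℕ → ℕ} (hs : Monotone s) (i n : ℕ) :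
    occCount x u (s i) (s (i + n)) =
      ∑ j ∈ Finset.range n, occCount x u (s (i + j)) (s (i + j + 1)) := by
  induction n with
  | zero => simp [occCount]
  | succ n ih =>
    rw [Finset.sum_range_succ, ← ih, ← occCount_add x u (hs (by omega)) (hs (by omega)), add_assoc]

theorem PowerFree.lt_mul_of_occursAt {y : ℕ → A} {P : ℕ} (hy : PowerFree P y) {u : List A}
    {p d : ℕ} (hd : 0 < d) (h1 : OccursAt y u p) (h2 : OccursAt y u (p + d)) :
    u.length < P * d := by
  by_contra! hle
  have hdu : d ≤ u.length ∨ P = 0 := by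
    rcases Nat.eq_zero_or_pos P with h | h
    · exact Or.inr h
    · exact Or.inl (le_trans (Nat.le_mul_of_pos_left d h) hle)
  rcases hdu with hdu | rfl
  · have hlen : (u.take d).length = d := by simp [hdu]
    have key : ∀ m, m * d ≤ u.length → OccursAt y (List.replicate m (u.take d)).flatten p := by
      intro m
      induction m with
      | zero => intro _; simp [OccursAt]
      | succ m ih =>
        intro hm
        rw [Nat.succ_mul] at hm
        have ih' := ih (by omega)
        rw [List.replicate_succ, List.flatten_cons, occursAt_append]
        refine ⟨h1.take d, ?_⟩
        rw [hlen]
        rw [occursAt_iff] at ih' h1 h2 ⊢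
        intro j hj
        have hju : j < u.length := by
          have : (List.replicate m (u.take d)).flatten.length = m * d := by
            simp [hdu]
          omega
        rw [ih' j hj, ← h1 j hju, h2 j hju]
    exact hy (u.take d) (List.ne_nil_of_length_pos (by omega)) ⟨p, key P hle⟩
  · exact hy [y 0] (by simp) ⟨0, by simp [OccursAt]⟩

theorem PowerFree.occCount_mul_le {y : ℕ → A} {P : ℕ} (hy : PowerFree P y) (u : List A)
    (s e : ℕ) : occCount y u s e * u.length ≤ P * (e - s) + u.length := by
  have hcard : occCount y u s e * u.length =
      (((Finset.Ico s e).filter fun p => OccursAt y u p) ×ˢ Finset.range u.length).card := by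
    simp [occCount]
  by_cases hse : s ≤ e
  swap
  · simp [occCount, Finset.Ico_eq_empty_of_le (not_le.1 hse).le]
  rw [hcard, show P * (e - s) + u.length = (Finset.Ico (P * s) (P * e + u.length)).card by
    rw [Nat.card_Ico, Nat.mul_sub]
    have := Nat.mul_le_mul_left P hse
    omega]
  apply Finset.card_le_card_of_injOn (fun z => P * z.1 + z.2)
  · rintro ⟨p, j⟩ h
    simp only [Finset.coe_product, Set.mem_prod, Finset.mem_coe, Finset.mem_filter,
      Finset.mem_Ico, Finset.mem_range] at h ⊢
    have h1 := Nat.mul_le_mul_left P h.1.1.1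
    have h2 := Nat.mul_le_mul_left P h.1.1.2.le
    omega
  · have aux : ∀ p j q l, OccursAt y u p → OccursAt y u q → j < u.length → p < q →
        P * p + j ≠ P * q + l := by
      intro p j q l hp hq hj hpq heq
      obtain ⟨d, rfl⟩ := Nat.exists_eq_add_of_lt hpq
      have := hy.lt_mul_of_occursAt (Nat.succ_pos d) hp hq
      rw [add_assoc, Nat.mul_add] at heq
      simp only [Nat.succ_eq_add_one] at this
      omega
    rintro ⟨p, j⟩ h ⟨q, l⟩ h' heq
    simp only [Finset.coe_product, Set.mem_prod, Finset.mem_coe, Finset.mem_filter,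
      Finset.mem_Ico, Finset.mem_range] at h h' heq
    rcases lt_trichotomy p q with hpq | rfl | hpq
    · exact absurd heq (aux p j q l h.1.2 h'.1.2 h.2 hpq)
    · simp only [Prod.mk.injEq, true_and]
      omega
    · exact absurd heq.symm (aux q l p j h'.1.2 h.1.2 h'.2 hpq)

end Occurrences

section Letters

variable {A : Type*}

theorem wordPrefix_add (x : ℕ → A) (i n : ℕ) :
    wordPrefix x (i + n) = wordPrefix x i ++ (List.range n).map fun j => x (i + j) := by
  simp [wordPrefix, List.range_add, Function.comp_def]

theorem countOccs_wordPrefix (x : ℕ → A) {u : List A} (hu : 1 ≤ u.length) (n : ℕ) :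
    countOccs (wordPrefix x n) u = occCount x u 0 (n + 1 - u.length) := by
  have h : OccursAt x (wordPrefix x n) 0 := by simpa [wordPrefix] using occursAt_map_range x 0 n
  rw [countOccs_eq_occCount h hu]
  simp [wordPrefix]

theorem countOccs_singleton_of_occursAt {x : ℕ → A} {w : List A} {i : ℕ} (h : OccursAt x w i)
    (a : A) : countOccs w [a] = occCount x [a] i (i + w.length) := by
  rw [countOccs_eq_occCount h (by simp)]
  simp

theorem sum_occCount_singleton_mul [Fintype A] (x : ℕ → A) (f : A → ℝ) (i n : ℕ) :
    ∑ a : A, (occCount x [a] i (i + n) : ℝ) * f a = ∑ j ∈ Finset.range n, f (x (i + j)) := by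
  simp only [occCount, occursAt_singleton, Finset.card_filter, Nat.cast_sum, Finset.sum_mul]
  rw [Finset.sum_comm, Finset.sum_Ico_eq_sum_range]
  simp

theorem HasFreq.nonneg {x : ℕ → A} {w : List A} {μ : ℝ} (h : HasFreq x w μ) : 0 ≤ μ :=
  ge_of_tendsto' h fun _ => by positivity

theorem HasFreq.sum_eq_one [Fintype A] {x : ℕ → A} {ν : A → ℝ}
    (hν : ∀ a : A, HasFreq x [a] (ν a)) : ∑ a : A, ν a = 1 := by
  have h := tendsto_finsetSum Finset.univ fun a _ => hν a
  refine tendsto_nhds_unique h (tendsto_const_nhds.congr' ?_)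
  filter_upwards [Filter.eventually_gt_atTop 0] with n hn
  have := sum_occCount_singleton_mul x (fun _ => (1 : ℝ)) 0 n
  simp only [mul_one, zero_add, Finset.sum_const, Finset.card_range, nsmul_eq_mul] at this
  rw [← Finset.sum_div]
  simp only [countOccs_wordPrefix x (u := [_]) (by simp), List.length_singleton,
    Nat.add_sub_cancel]
  rw [this, div_self (by positivity)]

theorem HasFreq.eq_zero_of_forall_ne {x : ℕ → A} {a : A} {μ : ℝ} (h : HasFreq x [a] μ)
    (ha : ∀ i, 1 ≤ i → x i ≠ a) : μ = 0 := by
  have hb : ∀ n, occCount x [a] 0 n ≤ 1 := by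
    intro n
    refine (occCount_le_add x [a] 0 1 n).trans ?_
    have h1 : occCount x [a] 1 n = 0 := by
      simp only [occCount, Finset.card_eq_zero, Finset.filter_eq_empty_iff, Finset.mem_Ico,
        occursAt_singleton]
      exact fun p hp => ha p hp.1
    have := occCount_le x [a] 0 1
    omega
  refine tendsto_nhds_unique h (squeeze_zero (fun n => by positivity) (fun n => ?_)
    tendsto_one_div_atTop_nhds_zero_nat)
  rw [countOccs_wordPrefix x (by simp)]
  gcongr
  exact_mod_cast hb _

theorem LetterBalanced.abs_occCount_sub_le {x : ℕ → A} {C : ℝ} (hC : 0 ≤ C)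
    (hx : LetterBalanced C x) {a : A} {μ : ℝ} (hμ : HasFreq x [a] μ) (i n : ℕ) :
    |(occCount x [a] i (i + n) : ℝ) - μ * n| ≤ C := by
  rcases Nat.eq_zero_or_pos n with rfl | hn
  · simpa [occCount] using hC
  have hpair : ∀ j, |(occCount x [a] j (j + n) : ℝ) - occCount x [a] i (i + n)| ≤ C := by
    intro j
    have hj := occursAt_map_range x j n
    have hi := occursAt_map_range x i n
    have := hx a _ _ ⟨j, hj⟩ ⟨i, hi⟩ (by simp)
    rw [countOccs_singleton_of_occursAt hj, countOccs_singleton_of_occursAt hi] at this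
    simpa using this
  have hsum : ∀ m : ℕ, |(occCount x [a] 0 (m * n) : ℝ) - m * occCount x [a] i (i + n)| ≤ m * C := by
    intro m
    induction m with
    | zero => simp [occCount]
    | succ m ih =>
      rw [occCount_add x [a] (Nat.zero_le (m * n)) (Nat.mul_le_mul_right n (Nat.le_succ m)),
        Nat.succ_mul]
      have h1 := abs_le.1 ih
      have h2 := abs_le.1 (hpair (m * n))
      push_cast
      rw [abs_le]
      constructor <;> linarith
  have hlim : Filter.Tendsto (fun m : ℕ =>
      |(n : ℝ) * ((occCount x [a] 0 (m * n) : ℝ) / ((m * n : ℕ) : ℝ)) - occCount x [a] i (i + n)|)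
      Filter.atTop (nhds |(n : ℝ) * μ - occCount x [a] i (i + n)|) := by
    refine ((Filter.Tendsto.const_mul _ ?_).sub_const _).abs
    have := hμ.comp (Filter.tendsto_id.atTop_mul_const' hn)
    refine this.congr fun m => ?_
    simp [countOccs_wordPrefix x (u := [a]) (by simp)]
  rw [abs_sub_comm, mul_comm]
  refine le_of_tendsto hlim ?_
  filter_upwards [Filter.eventually_gt_atTop 0] with m hm
  have hm' : (0 : ℝ) < m := by exact_mod_cast hm
  have hn' : (0 : ℝ) < n := by exact_mod_cast hn
  have : (n : ℝ) * ((occCount x [a] 0 (m * n) : ℝ) / ((m * n : ℕ) : ℝ)) -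
      occCount x [a] i (i + n) =
      ((occCount x [a] 0 (m * n) : ℝ) - m * occCount x [a] i (i + n)) / m := by
    push_cast
    field_simp
  rw [this, abs_div, abs_of_pos hm', div_le_iff₀ hm', mul_comm C]
  exact hsum m

end Letters

section Substitution

variable {A : Type*} {B : Type*}

theorem substWord_append (τ : A → List B) (v w : List A) :
    substWord τ (v ++ w) = substWord τ v ++ substWord τ w := by
  simp [substWord]

/-- The length of the image under `τ` of the length-`n` prefix of `x`. -/
def imageLength (τ : A → List B) (x : ℕ → A) (n : ℕ) : ℕ :=
  (substWord τ (wordPrefix x n)).length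

theorem imageLength_succ (τ : A → List B) (x : ℕ → A) (n : ℕ) :
    imageLength τ x (n + 1) = imageLength τ x n + (τ (x n)).length := by
  simp [imageLength, wordPrefix_add, substWord]

theorem imageLength_monotone (τ : A → List B) (x : ℕ → A) : Monotone (imageLength τ x) :=
  monotone_nat_of_le_succ fun n => by rw [imageLength_succ]; omega

theorem imageLength_add (τ : A → List B) (x : ℕ → A) (i n : ℕ) :
    imageLength τ x (i + n) =
      imageLength τ x i + ∑ j ∈ Finset.range n, (τ (x (i + j))).length := by
  induction n with
  | zero => simp
  | succ n ih => rw [← add_assoc, imageLength_succ, ih, Finset.sum_range_succ, add_assoc]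

theorem occursAt_substInf_wordPrefix [Nonempty B] (τ : A → List B) (x : ℕ → A) (n : ℕ) :
    OccursAt (substInf τ x) (substWord τ (wordPrefix x n)) 0 := by
  rw [occursAt_iff]
  intro j hj
  have hex : ∃ n, j < (substWord τ (wordPrefix x n)).length := ⟨n, hj⟩
  have hle : Nat.find hex ≤ n := Nat.find_min' hex hj
  obtain ⟨d, hd⟩ := Nat.exists_eq_add_of_le hle
  have hspec := Nat.find_spec hex
  rw [zero_add, substInf, dif_pos hex]
  rw [List.get_eq_getElem, ← List.getElem?_eq_getElem]
  conv_lhs => rw [hd, wordPrefix_add, substWord_append, List.getElem?_append_left hspec]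

theorem occursAt_substInf [Nonempty B] (τ : A → List B) {x : ℕ → A} {w : List A} {i : ℕ}
    (hw : OccursAt x w i) : OccursAt (substInf τ x) (substWord τ w) (imageLength τ x i) := by
  have h := occursAt_substInf_wordPrefix τ x (i + w.length)
  rw [wordPrefix_add, substWord_append, occursAt_append, zero_add] at h
  rw [OccursAt] at hw
  rw [hw]
  exact h.2

theorem length_substWord_of_occursAt (τ : A → List B) {x : ℕ → A} {w : List A} {i : ℕ}
    (hw : OccursAt x w i) :
    imageLength τ x (i + w.length) = imageLength τ x i + (substWord τ w).length := by
  rw [imageLength, wordPrefix_add, substWord_append, List.length_append, imageLength]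
  rw [OccursAt] at hw
  rw [← hw]

theorem occursAt_substInf_letter [Nonempty B] (τ : A → List B) (x : ℕ → A) (i : ℕ) :
    OccursAt (substInf τ x) (τ (x i)) (imageLength τ x i) := by
  simpa [substWord] using occursAt_substInf τ (w := [x i]) (occursAt_singleton.2 rfl)

namespace DecisiveWith

variable {τ : A → List B} {x : ℕ → A} {r : A → List B} {k : ℕ}

theorem le_length (h : DecisiveWith τ x r k) {i : ℕ} (hi : 1 ≤ i) :
    k ≤ (τ (x i)).length := by
  obtain ⟨j, rfl⟩ := Nat.exists_eq_add_of_le' hi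
  rw [← h.2.1 (x j)]
  exact (h.2.2 _ _ (isFactor_pair x j)).length_le

theorem countOccs_eq [Nonempty B] (h : DecisiveWith τ x r k) {u : List B} (hu : 1 ≤ u.length)
    (huk : u.length ≤ k + 1) (i : ℕ) :
    countOccs (τ (x i) ++ (r (x i)).take (u.length - 1)) u =
      occCount (substInf τ x) u (imageLength τ x i) (imageLength τ x (i + 1)) := by
  have h1 : OccursAt (substInf τ x) (τ (x i) ++ (r (x i)).take (u.length - 1))
      (imageLength τ x i) := by
    rw [occursAt_append, ← imageLength_succ]
    exact ⟨occursAt_substInf_letter τ x i, (occursAt_substInf_letter τ x (i + 1)).of_isPrefix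
      (.trans ⟨_, List.take_append_drop _ _⟩ (h.2.2 _ _ (isFactor_pair x i)))⟩
  rw [countOccs_eq_occCount h1 hu, imageLength_succ]
  congr 1
  simp only [List.length_append, List.length_take, h.2.1]
  omega

theorem le_imageLength (h : DecisiveWith τ x r k) (n : ℕ) : n ≤ imageLength τ x (n + 1) := by
  induction n with
  | zero => omega
  | succ n ih =>
    rw [imageLength_succ]
    have := h.le_length (i := n + 1) (by omega)
    have := h.1
    omega

end DecisiveWith

/-- The estimate on occurrences in images of factors extends to a frequency in `τ(x)`. -/
theorem hasFreq_substInf_of_abs_sub_le [Fintype A] [Nonempty B] {τ : A → List B} {x : ℕ → A}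
    {r : A → List B} {k : ℕ} (hdec : DecisiveWith τ x r k) {u : List B} (hu : 1 ≤ u.length)
    {μ C : ℝ} (h : ∀ n, |(countOccs (substWord τ (wordPrefix x n)) u : ℝ) -
      μ * (imageLength τ x n : ℝ)| ≤ C) :
    HasFreq (substInf τ x) u μ := by
  set T : ℕ := ∑ a : A, (τ a).length with hT
  have hstep : ∀ n, |(countOccs (wordPrefix (substInf τ x) n) u : ℝ) - μ * n| ≤
      C + T + |μ| * T := by
    intro n
    have hex : ∃ m, n < imageLength τ x (m + 1) := by
      refine ⟨n + 1, ?_⟩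
      have := hdec.le_imageLength (n + 1)
      omega
    obtain ⟨m, hm, hmin⟩ : ∃ m, n < imageLength τ x (m + 1) ∧ imageLength τ x m ≤ n := by
      refine ⟨Nat.find hex, Nat.find_spec hex, ?_⟩
      rcases hf : Nat.find hex with _ | m
      · simp [imageLength, wordPrefix, substWord]
      · exact not_lt.1 (Nat.find_min hex (m := m) (by omega))
    have hτ : (τ (x m)).length ≤ T :=
      Finset.single_le_sum (f := fun a => (τ a).length) (fun _ _ => Nat.zero_le _)
        (Finset.mem_univ (x m))
    rw [imageLength_succ] at hm
    have hpre := countOccs_eq_occCount (occursAt_substInf_wordPrefix τ x m) hu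
    rw [zero_add] at hpre
    change _ = occCount _ _ _ (imageLength τ x m + 1 - u.length) at hpre
    have hn := countOccs_wordPrefix (substInf τ x) hu n
    have hle : countOccs (substWord τ (wordPrefix x m)) u ≤
        countOccs (wordPrefix (substInf τ x) n) u := by
      rw [hpre, hn]
      exact occCount_mono _ _ _ (by omega)
    have hge : countOccs (wordPrefix (substInf τ x) n) u ≤
        countOccs (substWord τ (wordPrefix x m)) u + T := by
      rw [hpre, hn]
      refine (occCount_le_add _ _ _ (imageLength τ x m + 1 - u.length) _).trans ?_
      have := occCount_le (substInf τ x) u (imageLength τ x m + 1 - u.length) (n + 1 - u.length)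
      omega
    have hnT : n ≤ imageLength τ x m + T := by omega
    have hle' : (countOccs (substWord τ (wordPrefix x m)) u : ℝ) ≤
        countOccs (wordPrefix (substInf τ x) n) u := by exact_mod_cast hle
    have hge' : (countOccs (wordPrefix (substInf τ x) n) u : ℝ) ≤
        countOccs (substWord τ (wordPrefix x m)) u + T := by exact_mod_cast hge
    have hmin' : (imageLength τ x m : ℝ) ≤ n := by exact_mod_cast hmin
    have hnT' : (n : ℝ) ≤ imageLength τ x m + T := by exact_mod_cast hnT
    have hμ : |μ * (n - imageLength τ x m)| ≤ |μ| * T := by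
      rw [abs_mul, abs_of_nonneg (sub_nonneg.2 hmin')]
      gcongr
      linarith
    have h1 := abs_le.1 (h m)
    have h2 := abs_le.1 hμ
    rw [abs_le]
    constructor <;> nlinarith
  have h0 : Filter.Tendsto (fun n : ℕ =>
      (countOccs (wordPrefix (substInf τ x) n) u : ℝ) / n - μ) Filter.atTop (nhds 0) := by
    refine squeeze_zero_norm' ?_ (tendsto_const_div_atTop_nhds_zero_nat (C + T + |μ| * T))
    filter_upwards [Filter.eventually_gt_atTop 0] with n hn
    have hn' : (0 : ℝ) < n := by exact_mod_cast hn
    rw [Real.norm_eq_abs, show (countOccs (wordPrefix (substInf τ x) n) u : ℝ) / n - μ =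
      ((countOccs (wordPrefix (substInf τ x) n) u : ℝ) - μ * n) / n by field_simp,
      abs_div, abs_of_pos hn']
    gcongr
    exact hstep n
  simpa [HasFreq] using h0.add_const μ

end Substitution

/-- Proposition: let `x` be `Bc`-letter-balanced with letter frequencies `ν`, let `τ` be
`k`-decisive in `x` with map `r`, and suppose `τ(x)` is `P`-power-free. For a factor `u`
of `τ(x)` with `1 ≤ |u| ≤ k+1` and
`μu = (Σ_a ν a · q_{τ,x}(u,a)) / (Σ_a ν a · |τ a|)`, every factor `w` of `x` satisfies
`||τ(w)|_u − μu·|τ(w)|| ≤ 2·P·Bc·‖τ‖/|u| + 2·P`; in particular the frequency of `u` in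
`τ(x)` exists and equals `μu`. -/
theorem stmt14 {A B : Type*} [Fintype A] [Nonempty B] (x : ℕ → A)
    (Bc : ℝ) (hBc : 0 < Bc) (hlb : LetterBalanced Bc x)
    (ν : A → ℝ) (hν : ∀ a : A, HasFreq x [a] (ν a))
    (τ : A → List B) (k : ℕ) (r : A → List B) (hdec : DecisiveWith τ x r k)
    (P : ℕ) (hP : 1 ≤ P) (hpf : PowerFree P (substInf τ x))
    (u : List B) (hufac : IsFactor (substInf τ x) u)
    (hu1 : 1 ≤ u.length) (huk : u.length ≤ k + 1)
    (μu : ℝ)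
    (hμu : μu = (∑ a : A, ν a * (countOccs (τ a ++ (r a).take (u.length - 1)) u : ℝ)) /
      (∑ a : A, ν a * ((τ a).length : ℝ))) :
    (∀ w : List A, IsFactor x w →
        |(countOccs (substWord τ w) u : ℝ) - μu * ((substWord τ w).length : ℝ)| ≤
          2 * (P : ℝ) * Bc * (∑ a : A, ((τ a).length : ℝ)) / (u.length : ℝ) +
            2 * (P : ℝ)) ∧
      HasFreq (substInf τ x) u μu := by
  set t : A → ℝ := fun a => ((τ a).length : ℝ) with ht
  set q : A → ℝ := fun a => (countOccs (τ a ++ (r a).take (u.length - 1)) u : ℝ) with hq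
  set U : ℝ := (u.length : ℝ) with hU
  have hU0 : 0 < U := by rw [hU]; exact_mod_cast hu1
  have hP2 : 2 ≤ P := by
    by_contra hlt
    obtain rfl : P = 1 := by omega
    exact hpf u (List.ne_nil_of_length_pos hu1) (by simpa using hufac)
  have hq0 : ∀ a, 0 ≤ q a := fun a => Nat.cast_nonneg _
  have ht0 : ∀ a, 0 ≤ t a := fun a => Nat.cast_nonneg _
  have hν0 : ∀ a, 0 ≤ ν a := fun a => (hν a).nonneg
  have hqN : ∀ i, countOccs (τ (x i) ++ (r (x i)).take (u.length - 1)) u * u.length ≤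
      P * (τ (x i)).length + u.length := by
    intro i
    have := hpf.occCount_mul_le u (imageLength τ x i) (imageLength τ x (i + 1))
    rwa [← hdec.countOccs_eq hu1 huk, imageLength_succ, Nat.add_sub_cancel_left] at this
  have hqx : ∀ i, q (x i) ≤ 2 * P * t (x i) / U + 1 := by
    intro i
    have h : q (x i) * U ≤ P * t (x i) + U := by
      simp only [hq, ht, hU]
      exact_mod_cast hqN i
    have h' : 0 ≤ P * t (x i) := by have := ht0 (x i); positivity
    rw [div_add_one hU0.ne', le_div_iff₀ hU0]
    linarith
  have hlate : ∀ i, 1 ≤ i → q (x i) ≤ 2 * P * t (x i) / U := by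
    intro i hi
    have h1 := hqN i
    have h2 := hdec.le_length hi
    have h3 := hdec.1
    have h4 : 2 * (τ (x i)).length ≤ P * (τ (x i)).length := Nat.mul_le_mul_right _ hP2
    have h5 : countOccs (τ (x i) ++ (r (x i)).take (u.length - 1)) u * u.length ≤
      2 * P * (τ (x i)).length := by
      rw [mul_assoc]
      omega
    rw [le_div_iff₀ hU0]
    simp only [hq, ht, hU]
    exact_mod_cast h5
  have hνlate : ∀ a, ν a ≠ 0 → ∃ i, 1 ≤ i ∧ x i = a := by
    intro a ha
    by_contra! hcon
    exact ha ((hν a).eq_zero_of_forall_ne hcon)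
  have hνt : ∀ a, ν a ≤ ν a * t a := by
    intro a
    by_cases ha : ν a = 0
    · simp [ha]
    · obtain ⟨i, hi, rfl⟩ := hνlate a ha
      have h1 : (1 : ℝ) ≤ t (x i) := by
        have := (hdec.1.trans (hdec.le_length hi))
        simp only [ht]
        exact_mod_cast this
      nlinarith [hν0 (x i)]
  have hD : 0 < ∑ a : A, ν a * t a := by
    have h1 := HasFreq.sum_eq_one hν
    have h2 := Finset.sum_le_sum fun a (_ : a ∈ Finset.univ) => hνt a
    linarith
  have hμ0 : 0 ≤ μu := by
    rw [hμu]
    exact div_nonneg (Finset.sum_nonneg fun a _ => mul_nonneg (hν0 a) (hq0 a)) hD.le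
  have hμle : μu ≤ 2 * P / U := by
    rw [hμu, div_le_iff₀ hD, Finset.mul_sum]
    refine Finset.sum_le_sum fun a _ => ?_
    by_cases ha : ν a = 0
    · simp [ha]
    · obtain ⟨i, hi, rfl⟩ := hνlate a ha
      calc ν (x i) * q (x i) ≤ ν (x i) * (2 * P * t (x i) / U) :=
            mul_le_mul_of_nonneg_left (hlate i hi) (hν0 _)
        _ = 2 * P / U * (ν (x i) * t (x i)) := by ring
  have hμt : ∀ a, μu * t a ≤ 2 * P * t a / U := by
    intro a
    calc μu * t a ≤ 2 * P / U * t a := mul_le_mul_of_nonneg_right hμle (ht0 a)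
      _ = 2 * P * t a / U := by ring
  have hzero : ∑ a : A, ν a * (q a - μu * t a) = 0 := by
    have h1 : μu * ∑ a : A, ν a * t a = ∑ a : A, ν a * q a := by
      rw [hμu, div_mul_cancel₀ _ hD.ne']
    rw [Finset.mul_sum] at h1
    rw [← sub_eq_zero.2 h1.symm, ← Finset.sum_sub_distrib]
    exact Finset.sum_congr rfl fun a _ => by ring
  have hmain : ∀ w : List A, IsFactor x w →
      |(countOccs (substWord τ w) u : ℝ) - μu * ((substWord τ w).length : ℝ)| ≤
        2 * (P : ℝ) * Bc * (∑ a : A, t a) / U + 2 * (P : ℝ) := by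
    rintro w ⟨i, hw⟩
    set n := w.length with hn
    have hlen := length_substWord_of_occursAt τ hw
    have hsumt : ((substWord τ w).length : ℝ) = ∑ j ∈ Finset.range n, t (x (i + j)) := by
      have h : (substWord τ w).length = ∑ j ∈ Finset.range n, (τ (x (i + j))).length := by
        rw [← hn, imageLength_add] at hlen
        omega
      rw [h]
      push_cast
      rfl
    have hcount := countOccs_eq_occCount (occursAt_substInf τ hw) hu1
    rw [← hlen, ← hn] at hcount
    have hsumq : (occCount (substInf τ x) u (imageLength τ x i) (imageLength τ x (i + n)) : ℝ) =
        ∑ j ∈ Finset.range n, q (x (i + j)) := by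
      rw [occCount_eq_sum _ _ (imageLength_monotone τ x)]
      push_cast
      exact Finset.sum_congr rfl fun j _ => by rw [← hdec.countOccs_eq hu1 huk]
    have hbd1 : countOccs (substWord τ w) u ≤
        occCount (substInf τ x) u (imageLength τ x i) (imageLength τ x (i + n)) := by
      rw [hcount]
      exact occCount_mono _ _ _ (by omega)
    have hbd2 : occCount (substInf τ x) u (imageLength τ x i) (imageLength τ x (i + n)) ≤
        countOccs (substWord τ w) u + P := by
      rw [hcount]
      refine (occCount_le_add _ _ _ (imageLength τ x (i + n) + 1 - u.length) _).trans ?_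
      gcongr
      set e := imageLength τ x (i + n)
      have h1 := hpf.occCount_mul_le u (e + 1 - u.length) e
      have h2 : P * (e - (e + 1 - u.length)) ≤ P * (u.length - 1) :=
        Nat.mul_le_mul_left _ (by omega)
      have h3 : P * (u.length - 1) < P * u.length :=
        Nat.mul_lt_mul_of_pos_left (by omega) (by omega)
      have h4 : occCount (substInf τ x) u (e + 1 - u.length) e * u.length <
          (P + 1) * u.length := by
        rw [Nat.succ_mul]
        omega
      exact Nat.lt_succ_iff.1 (Nat.lt_of_mul_lt_mul_right h4)
    have hbd1' : (countOccs (substWord τ w) u : ℝ) ≤ ∑ j ∈ Finset.range n, q (x (i + j)) := by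
      rw [← hsumq]
      exact_mod_cast hbd1
    have hbd2' : ∑ j ∈ Finset.range n, q (x (i + j)) ≤ (countOccs (substWord τ w) u : ℝ) + P := by
      rw [← hsumq]
      exact_mod_cast hbd2
    have hterm : ∀ a, |((occCount x [a] i (i + n) : ℝ) - ν a * n) * (q a - μu * t a)| ≤
        Bc * (2 * P * t a / U) + if a = x 0 then 1 else 0 := by
      intro a
      have hδ := hlb.abs_occCount_sub_le hBc.le (hν a) i n
      have hX : 0 ≤ 2 * P * t a / U := by have := ht0 a; positivity
      have hμt0 := mul_nonneg hμ0 (ht0 a)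
      rw [abs_mul]
      by_cases ha : ∃ j, 1 ≤ j ∧ x j = a
      · obtain ⟨j, hj, rfl⟩ := ha
        have h1 : |q (x j) - μu * t (x j)| ≤ 2 * P * t (x j) / U :=
          abs_le.2 ⟨by linarith [hq0 (x j), hμt (x j)], by linarith [hlate j hj]⟩
        have h2 := mul_le_mul hδ h1 (abs_nonneg _) hBc.le
        have h3 : (0 : ℝ) ≤ if x j = x 0 then 1 else 0 := by split_ifs <;> norm_num
        linarith
      · push Not at ha
        have hν' : ν a = 0 := (hν a).eq_zero_of_forall_ne ha
        rw [hν', zero_mul, sub_zero] at hδ ⊢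
        by_cases ha0 : a = x 0
        · have hone : occCount x [a] i (i + n) ≤ 1 := by
            unfold occCount
            refine Finset.card_le_one.2 fun p hp p' hp' => ?_
            simp only [Finset.mem_filter, occursAt_singleton] at hp hp'
            have h1 : p = 0 := by
              by_contra hne
              exact ha p (by omega) hp.2
            have h2 : p' = 0 := by
              by_contra hne
              exact ha p' (by omega) hp'.2
            rw [h1, h2]
          have hone' : |(occCount x [a] i (i + n) : ℝ)| ≤ 1 := by
            rw [Nat.abs_cast]
            exact_mod_cast hone
          have h1 : |q a - μu * t a| ≤ 2 * P * t a / U + 1 := by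
            have := hqx 0
            rw [← ha0] at this
            exact abs_le.2 ⟨by linarith [hq0 a, hμt a], by linarith⟩
          rw [if_pos ha0]
          calc |(occCount x [a] i (i + n) : ℝ)| * |q a - μu * t a|
              ≤ |(occCount x [a] i (i + n) : ℝ)| * (2 * P * t a / U + 1) :=
                mul_le_mul_of_nonneg_left h1 (abs_nonneg _)
            _ ≤ Bc * (2 * P * t a / U) + 1 := by
                rw [mul_add, mul_one]
                exact add_le_add (mul_le_mul_of_nonneg_right hδ hX) hone'
        · have hz : occCount x [a] i (i + n) = 0 := by
            simp only [occCount, Finset.card_eq_zero, Finset.filter_eq_empty_iff,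
              occursAt_singleton]
            intro p _ hp
            rcases Nat.eq_zero_or_pos p with rfl | hp0
            · exact ha0 hp.symm
            · exact ha p hp0 hp
          rw [hz, if_neg ha0]
          simpa using mul_nonneg hBc.le hX
    have hsum : ∑ j ∈ Finset.range n, q (x (i + j)) - μu * ((substWord τ w).length : ℝ) =
        ∑ a : A, ((occCount x [a] i (i + n) : ℝ) - ν a * n) * (q a - μu * t a) := by
      have h1 := sum_occCount_singleton_mul x (fun a => q a - μu * t a) i n
      simp only [sub_mul, Finset.sum_sub_distrib (f := fun a => (occCount x [a] i (i + n) : ℝ) * _),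
        mul_right_comm _ (n : ℝ), ← Finset.sum_mul] at h1 ⊢
      rw [h1, hzero, zero_mul, sub_zero, hsumt, Finset.sum_sub_distrib, Finset.mul_sum]
    have hdisc : |∑ j ∈ Finset.range n, q (x (i + j)) - μu * ((substWord τ w).length : ℝ)| ≤
        2 * (P : ℝ) * Bc * (∑ a : A, t a) / U + 1 := by
      rw [hsum]
      refine (Finset.abs_sum_le_sum_abs _ _).trans
        ((Finset.sum_le_sum fun a _ => hterm a).trans_eq ?_)
      rw [Finset.sum_add_distrib, Finset.sum_ite_eq' Finset.univ (x 0), if_pos (Finset.mem_univ _),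
        Finset.mul_sum, Finset.sum_div]
      congr 1
      exact Finset.sum_congr rfl fun a _ => by ring
    have hP' : (1 : ℝ) ≤ P := by exact_mod_cast hP
    have h1 := abs_le.1 hdisc
    rw [abs_le]
    constructor <;> linarith
  refine ⟨hmain, hasFreq_substInf_of_abs_sub_le hdec hu1 fun n => hmain (wordPrefix x n) ⟨0, ?_⟩⟩
  simpa [wordPrefix] using occursAt_map_range x 0 n
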